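/- arXiv:math/0309418 — 2 statements merged into one kernel-verified Lean document; each statement's English description precedes it below -/
import Mathlib

section
/- Let n ≥ 1 and p ≥ 1. For all homogeneous matrices X₁, …, X_{4p+1} ∈ osp(1,2n), the matrix 𝒜_{4p+1}(X₁,…,X_{4p+1}) again belongs to osp(1,2n). -/
open Matrix

/-- Index type for the ℤ₂-graded space ℂ^p ⊕ ℂ^q. -/
abbrev Idx (p q : ℕ) := Sum (Fin p) (Fin q)

/-- Parity of a basis index. -/
def ipar {p q : ℕ} : Idx p q → ZMod 2
  | Sum.inl _ => 0
  | Sum.inr _ => 1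

/-- `(-1)^a` for `a : ZMod 2`. -/
noncomputable def sgn (a : ZMod 2) : ℂ := if a = 1 then -1 else 1

/-- A matrix is homogeneous of parity `ε` iff it maps the graded piece of
parity `a` into the piece of parity `a + ε`; equivalently, its entry `X i j`
vanishes unless `ipar i = ipar j + ε`. -/
def HasParity {p q : ℕ} (X : Matrix (Idx p q) (Idx p q) ℂ) (ε : ZMod 2) : Prop :=
  ∀ i j, ipar i ≠ ipar j + ε → X i j = 0

/-- A vector is homogeneous of parity `ε`. -/
def VHasParity {p q : ℕ} (u : Idx p q → ℂ) (ε : ZMod 2) : Prop :=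
  ∀ i, ipar i ≠ ε → u i = 0

/-- The super sign `ε(σ, 𝒳) = (-1)^{K(σ,𝒳)}`, where `K(σ,𝒳)` is the number of
pairs `(i,j)` with `i < j`, `σ i > σ j` and both `X (σ i)`, `X (σ j)` odd
(here only the parities `px` of the `X`'s matter). -/
noncomputable def superSign {k : ℕ} (σ : Equiv.Perm (Fin k)) (px : Fin k → ZMod 2) : ℂ :=
  (-1 : ℂ) ^ (Finset.univ.filter (fun ij : Fin k × Fin k =>
      ij.1 < ij.2 ∧ σ ij.2 < σ ij.1 ∧ px (σ ij.1) = 1 ∧ px (σ ij.2) = 1)).card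

/-- The ordered matrix product `X (σ 0) * X (σ 1) * ⋯ * X (σ (k-1))`. -/
noncomputable def permProd {k p q : ℕ} (σ : Equiv.Perm (Fin k))
    (X : Fin k → Matrix (Idx p q) (Idx p q) ℂ) : Matrix (Idx p q) (Idx p q) ℂ :=
  (List.ofFn fun i => X (σ i)).prod

/-- The standard supersymmetric super polynomial `𝒫_k`. -/
noncomputable def symPoly {k p q : ℕ} (X : Fin k → Matrix (Idx p q) (Idx p q) ℂ)
    (px : Fin k → ZMod 2) : Matrix (Idx p q) (Idx p q) ℂ :=
  ∑ σ : Equiv.Perm (Fin k), superSign σ px • permProd σ X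

/-- The standard skew supersymmetric super polynomial `𝒜_k`. -/
noncomputable def skewPoly {k p q : ℕ} (X : Fin k → Matrix (Idx p q) (Idx p q) ℂ)
    (px : Fin k → ZMod 2) : Matrix (Idx p q) (Idx p q) ℂ :=
  ∑ σ : Equiv.Perm (Fin k),
    (((Equiv.Perm.sign σ : ℤ) : ℂ) * superSign σ px) • permProd σ X

/-- The supertrace `str X = tr A - tr D` of a matrix in `gl(p,q)`. -/
noncomputable def strace {p q : ℕ} (X : Matrix (Idx p q) (Idx p q) ℂ) : ℂ :=
  ∑ i : Fin p, X (Sum.inl i) (Sum.inl i) - ∑ j : Fin q, X (Sum.inr j) (Sum.inr j)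

/-- The super bracket `[A,B] = AB - (-1)^{|A||B|} BA` of homogeneous matrices
`A`, `B` of parities `a`, `b`. -/
noncomputable def sbr {p q : ℕ} (A : Matrix (Idx p q) (Idx p q) ℂ) (a : ZMod 2)
    (B : Matrix (Idx p q) (Idx p q) ℂ) (b : ZMod 2) : Matrix (Idx p q) (Idx p q) ℂ :=
  A * B - sgn (a * b) • (B * A)

/-- The matrix of the even bilinear form `B` on `ℂ ⊕ ℂ^{2n}`: it is `1` on the
even line, `0` between the even and odd parts, and the standard symplectic form
with matrix `[[0, Iₙ],[-Iₙ, 0]]` on `ℂ^{2n}`. -/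
noncomputable def Bmat (n : ℕ) : Matrix (Idx 1 (2*n)) (Idx 1 (2*n)) ℂ :=
  fun i j => match i, j with
  | Sum.inl _, Sum.inl _ => 1
  | Sum.inl _, Sum.inr _ => 0
  | Sum.inr _, Sum.inl _ => 0
  | Sum.inr a, Sum.inr b =>
      if a.val + n = b.val then 1 else if b.val + n = a.val then -1 else 0

/-- The bilinear form `B(u,v)` on `ℂ ⊕ ℂ^{2n}`. -/
noncomputable def Bform (n : ℕ) (u v : Idx 1 (2*n) → ℂ) : ℂ :=
  ∑ i, ∑ j, u i * Bmat n i j * v j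

/-- `X` is a homogeneous element of `osp(1,2n)` of parity `ε`:
`B(Xu,v) + (-1)^{|X||u|} B(u,Xv) = 0` for all homogeneous `u`, `v`. -/
def ospMem {n : ℕ} (X : Matrix (Idx 1 (2*n)) (Idx 1 (2*n)) ℂ) (ε : ZMod 2) : Prop :=
  HasParity X ε ∧
  ∀ (u v : Idx 1 (2*n) → ℂ) (εu εv : ZMod 2), VHasParity u εu → VHasParity v εv →
    Bform n (X.mulVec u) v + sgn (ε * εu) * Bform n u (X.mulVec v) = 0

lemma sgn_zero : sgn 0 = 1 := by simp [sgn]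

lemma sgn_add (a b : ZMod 2) : sgn (a + b) = sgn a * sgn b := by
  have h : a + b = 1 ↔ ¬(a = 1 ↔ b = 1) := by decide +revert
  simp only [sgn, h]
  by_cases ha : a = 1 <;> by_cases hb : b = 1 <;> simp only [ha, hb] <;> norm_num

lemma sgn_mul_self (a : ZMod 2) : sgn a * sgn a = 1 := by
  unfold sgn; split_ifs <;> norm_num

lemma sgn_sum {ι : Type*} (s : Finset ι) (f : ι → ZMod 2) :
    sgn (∑ i ∈ s, f i) = ∏ i ∈ s, sgn (f i) := by
  classical
  induction s using Finset.induction_on with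
  | empty => simp [sgn_zero]
  | insert a s ha ih => rw [Finset.sum_insert ha, Finset.prod_insert ha, sgn_add, ih]

lemma sgn_mul (a b : ZMod 2) : sgn (a * b) = if a = 1 ∧ b = 1 then -1 else 1 := by
  have h : a * b = 1 ↔ a = 1 ∧ b = 1 := by decide +revert
  simp only [sgn, h]

/-- The super sign of the order-reversing rearrangement of homogeneous elements of parities `c`. -/
noncomputable def reversalSign {k : ℕ} (c : Fin k → ZMod 2) : ℂ :=
  ∏ i, ∏ j, if i < j then sgn (c i * c j) else 1

lemma reversalSign_succ {k : ℕ} (c : Fin (k + 1) → ZMod 2) :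
    reversalSign c = sgn (c 0 * ∑ i : Fin k, c i.succ) * reversalSign fun i => c i.succ := by
  simp [reversalSign, Fin.prod_univ_succ, Finset.mul_sum, sgn_sum]

lemma superSign_eq_prod {k : ℕ} (σ : Equiv.Perm (Fin k)) (px : Fin k → ZMod 2) :
    superSign σ px =
      ∏ i, ∏ j, if i < j ∧ σ j < σ i then sgn (px (σ i) * px (σ j)) else 1 := by
  rw [superSign, ← Finset.prod_const, Finset.prod_filter, Fintype.prod_prod_type]
  refine Finset.prod_congr rfl fun i _ => Finset.prod_congr rfl fun j _ => ?_
  rw [sgn_mul]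
  split_ifs <;> tauto

lemma superSign_mul_revPerm {k : ℕ} (σ : Equiv.Perm (Fin k)) (px : Fin k → ZMod 2) :
    superSign (σ * Fin.revPerm) px = superSign σ px * reversalSign (px ∘ σ) := by
  have h : superSign (σ * Fin.revPerm) px =
      ∏ i, ∏ j, if i < j ∧ σ i < σ j then sgn (px (σ i) * px (σ j)) else 1 := by
    rw [superSign_eq_prod, Finset.prod_comm, ← Equiv.prod_comp Fin.revPerm]
    refine Finset.prod_congr rfl fun i _ => ?_
    rw [← Equiv.prod_comp Fin.revPerm]
    refine Finset.prod_congr rfl fun j _ => ?_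
    simp [mul_comm]
  rw [h, superSign_eq_prod, reversalSign, ← Finset.prod_mul_distrib]
  refine Finset.prod_congr rfl fun i _ => ?_
  rw [← Finset.prod_mul_distrib]
  refine Finset.prod_congr rfl fun j _ => ?_
  by_cases hij : i < j
  · rcases lt_or_gt_of_ne (σ.injective.ne hij.ne) with h | h
    · simp [hij, h, not_lt_of_gt h]
    · simp [hij, h, not_lt_of_gt h, sgn_mul_self]
  · simp [hij]

lemma Bform_eq_toBilin' (n : ℕ) (u v : Idx 1 (2*n) → ℂ) :
    Bform n u v = Matrix.toBilin' (Bmat n) u v := by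
  rw [Matrix.toBilin'_apply, Bform]

lemma HasParity.one {p q : ℕ} : HasParity (1 : Matrix (Idx p q) (Idx p q) ℂ) 0 := by
  intro i j h
  refine Matrix.one_apply_ne ?_
  rintro rfl
  simp at h

lemma HasParity.mul {p q : ℕ} {X Y : Matrix (Idx p q) (Idx p q) ℂ} {a b : ZMod 2}
    (hX : HasParity X a) (hY : HasParity Y b) : HasParity (X * Y) (a + b) := by
  intro i j h
  rw [Matrix.mul_apply]
  refine Finset.sum_eq_zero fun l _ => ?_
  by_cases hl : ipar l = ipar j + b
  · rw [hX i l (by rw [hl]; intro h'; apply h; rw [h']; ring), zero_mul]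
  · rw [hY l j hl, mul_zero]

lemma HasParity.mulVec {p q : ℕ} {X : Matrix (Idx p q) (Idx p q) ℂ} {a b : ZMod 2}
    {u : Idx p q → ℂ} (hX : HasParity X a) (hu : VHasParity u b) :
    VHasParity (X.mulVec u) (b + a) := by
  intro i h
  rw [Matrix.mulVec, dotProduct]
  refine Finset.sum_eq_zero fun l _ => ?_
  by_cases hl : ipar l = b
  · rw [hX i l (by rwa [hl]), zero_mul]
  · rw [hu l hl, mul_zero]

lemma HasParity.smul {p q : ℕ} {X : Matrix (Idx p q) (Idx p q) ℂ} {a : ZMod 2}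
    (hX : HasParity X a) (r : ℂ) : HasParity (r • X) a := fun i j h => by
  rw [Matrix.smul_apply, hX i j h, smul_zero]

lemma HasParity.sum {p q : ℕ} {ι : Type*} {s : Finset ι}
    {X : ι → Matrix (Idx p q) (Idx p q) ℂ} {a : ZMod 2}
    (hX : ∀ i ∈ s, HasParity (X i) a) : HasParity (∑ i ∈ s, X i) a := fun i j h => by
  rw [Matrix.sum_apply]
  exact Finset.sum_eq_zero fun l hl => hX l hl i j h

lemma HasParity.prod_ofFn {p q k : ℕ} {Y : Fin k → Matrix (Idx p q) (Idx p q) ℂ}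
    {c : Fin k → ZMod 2} (hY : ∀ i, HasParity (Y i) (c i)) :
    HasParity (List.ofFn Y).prod (∑ i, c i) := by
  induction k with
  | zero => simpa using HasParity.one
  | succ k ih =>
    rw [List.ofFn_succ, List.prod_cons, Fin.sum_univ_succ]
    exact (hY 0).mul (ih fun i => hY i.succ)

/-- The super-adjoint of a product of elements of `osp(1,2n)` is, up to sign, the reversed
product. -/
lemma Bform_prod_ofFn_mulVec {n k : ℕ} {Y : Fin k → Matrix (Idx 1 (2*n)) (Idx 1 (2*n)) ℂ}
    {c : Fin k → ZMod 2} (hY : ∀ i, ospMem (Y i) (c i)) {u v : Idx 1 (2*n) → ℂ}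
    {εu εv : ZMod 2} (hu : VHasParity u εu) (hv : VHasParity v εv) :
    Bform n ((List.ofFn Y).prod.mulVec u) v =
      (-1) ^ k * sgn ((∑ i, c i) * εu) * reversalSign c *
        Bform n u ((List.ofFn fun i => Y i.rev).prod.mulVec v) := by
  induction k generalizing v εv with
  | zero => simp [sgn_zero, reversalSign]
  | succ k ih =>
    have hprod := HasParity.prod_ofFn fun i : Fin k => (hY i.succ).1
    have hrev : (List.ofFn fun i => Y i.rev).prod =
        (List.ofFn fun i : Fin k => Y i.rev.succ).prod * Y 0 := by
      rw [List.ofFn_succ', List.concat_eq_append, List.prod_append, List.prod_singleton]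
      simp [Fin.rev_castSucc]
    have h0 := (hY 0).2 _ v _ _ (hprod.mulVec hu) hv
    rw [ih (fun i => hY i.succ) ((hY 0).1.mulVec hv)] at h0
    rw [List.ofFn_succ, List.prod_cons, ← Matrix.mulVec_mulVec, eq_neg_of_add_eq_zero_left h0,
      hrev, ← Matrix.mulVec_mulVec, reversalSign_succ, Fin.sum_univ_succ, add_mul, mul_add,
      sgn_add, sgn_add, pow_succ]
    ring

lemma sign_revPerm (k : ℕ) :
    Equiv.Perm.sign (Fin.revPerm : Equiv.Perm (Fin k)) = (-1) ^ (k * (k - 1) / 2) := by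
  have h (j : Fin k) :
      ∏ i ∈ Finset.Iio j, (if Fin.revPerm i < Fin.revPerm j then 1 else -1 : ℤˣ) =
        (-1) ^ (j : ℕ) := by
    rw [Finset.prod_congr rfl (g := fun _ => -1), Finset.prod_const, Fin.card_Iio]
    intro i hi
    simp [(Finset.mem_Iio.1 hi).le]
  rw [Equiv.Perm.sign_eq_prod_prod_Iio, Finset.prod_congr rfl fun j _ => h j,
    Finset.prod_pow_eq_pow_sum, Fin.sum_univ_eq_sum_range (fun i => i), Finset.sum_range_id]

lemma sign_revPerm_four_mul_add_one (p : ℕ) :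
    Equiv.Perm.sign (Fin.revPerm : Equiv.Perm (Fin (4 * p + 1))) = 1 := by
  have h : (4 * p + 1) * (4 * p + 1 - 1) / 2 = 2 * ((4 * p + 1) * p) :=
    Nat.div_eq_of_eq_mul_left two_pos (by rw [Nat.add_sub_cancel]; ring)
  rw [sign_revPerm, h, (even_two_mul _).neg_one_pow]

/-- `𝒜_{4p+1}` of homogeneous elements of `osp(1,2n)` again lies in `osp(1,2n)`
(as a homogeneous element of parity `|X₁|+…+|X_{4p+1}|`). -/
theorem skewPoly_mem_osp_one (n p : ℕ) (hn : 1 ≤ n) (hp : 1 ≤ p)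
    (X : Fin (4*p+1) → Matrix (Idx 1 (2*n)) (Idx 1 (2*n)) ℂ)
    (px : Fin (4*p+1) → ZMod 2) (hX : ∀ i, ospMem (X i) (px i)) :
    ospMem (skewPoly X px) (∑ i, px i) := by
  refine ⟨HasParity.sum fun σ _ => HasParity.smul ?_ _, fun u v εu εv hu hv => ?_⟩
  · rw [← Equiv.sum_comp σ]
    exact HasParity.prod_ofFn fun i => (hX (σ i)).1
  have key (σ : Equiv.Perm (Fin (4*p+1))) : Bform n ((permProd σ X).mulVec u) v =
      -sgn ((∑ i, px i) * εu) * reversalSign (px ∘ σ) *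
        Bform n u ((permProd (σ * Fin.revPerm) X).mulVec v) := by
    have h := Bform_prod_ofFn_mulVec (fun i => hX (σ i)) hu hv
    rw [Equiv.sum_comp σ px, Odd.neg_one_pow ⟨2 * p, by ring⟩, neg_one_mul] at h
    exact h
  have expand (w : Idx 1 (2*n) → ℂ) : (skewPoly X px).mulVec w =
      ∑ σ : Equiv.Perm (Fin (4*p+1)),
        (((Equiv.Perm.sign σ : ℤ) : ℂ) * superSign σ px) • (permProd σ X).mulVec w := by
    simp only [skewPoly, Matrix.sum_mulVec, Matrix.smul_mulVec]
  have left : Bform n ((skewPoly X px).mulVec u) v =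
      ∑ σ : Equiv.Perm (Fin (4*p+1)),
        (((Equiv.Perm.sign σ : ℤ) : ℂ) * superSign σ px) *
          Bform n ((permProd σ X).mulVec u) v := by
    simp only [Bform_eq_toBilin', expand, map_sum, map_smul, LinearMap.sum_apply,
      LinearMap.smul_apply, smul_eq_mul]
  have right : Bform n u ((skewPoly X px).mulVec v) =
      ∑ σ : Equiv.Perm (Fin (4*p+1)),
        (((Equiv.Perm.sign σ : ℤ) : ℂ) * superSign σ px) *
          Bform n u ((permProd σ X).mulVec v) := by
    simp only [Bform_eq_toBilin', expand, map_sum, map_smul, smul_eq_mul]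
  rw [left, right, ← Equiv.sum_comp (Equiv.mulRight Fin.revPerm) (fun σ =>
    (((Equiv.Perm.sign σ : ℤ) : ℂ) * superSign σ px) * Bform n u ((permProd σ X).mulVec v)),
    Finset.mul_sum, ← Finset.sum_add_distrib]
  refine Finset.sum_eq_zero fun σ _ => ?_
  rw [key, Equiv.coe_mulRight, superSign_mul_revPerm, map_mul, sign_revPerm_four_mul_add_one,
    mul_one]
  ring
end

section
/- Let n ≥ 1. For all homogeneous matrices X₁, …, X_{4n+3} ∈ osp(1,2n), one has str(𝒜_{4n+3}(X₁,…,X_{4n+3})) = 0; that is, the invariant Λ_{4n+3} vanishes identically on osp(1,2n). -/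
open Matrix

section DetDegree
open Polynomial
variable {m : Type*} [Fintype m] [DecidableEq m] {R : Type*} [CommRing R]

theorem Matrix.derivative_det_eq_trace (M : Matrix m m R[X]) :
    derivative M.det = (M.adjugate * M.map derivative).trace := by
  have h : ∀ i, (M.adjugate * M.map derivative) i i
      = (M.updateCol i fun a => derivative (M a i)).det := fun i => by
    rw [← cramer_apply, cramer_eq_adjugate_mulVec]
    rfl
  simp only [Matrix.trace, Matrix.diag, h, det_apply, derivative_sum]
  rw [Finset.sum_comm]
  refine Finset.sum_congr rfl fun σ _ => ?_
  rw [← Finset.smul_sum, Units.smul_def, Units.smul_def, derivative_smul, derivative_prod_finset]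
  congr 1
  refine Finset.sum_congr rfl fun i _ => ?_
  rw [← Finset.prod_erase_mul _ _ (Finset.mem_univ i)]
  congr 1
  · refine Finset.prod_congr rfl fun j hj => ?_
    rw [updateCol_ne (Finset.ne_of_mem_erase hj)]
  · rw [updateCol_self]

theorem Polynomial.isAddTorsionFree [IsAddTorsionFree R] : IsAddTorsionFree R[X] where
  nsmul_right_injective n hn p q h := by
    ext k
    have := congrArg (fun r => coeff r k) h
    simp only [coeff_smul] at this
    exact nsmul_right_injective hn this

theorem Matrix.det_C_smul_one_add_X_smul_of_sq_eq_zero [IsAddTorsionFree R] {δ : R}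
    (hδ : IsRegular δ) {N : Matrix m m R} (hN : N * N = 0) (ht : N.trace = 0) :
    (C δ • (1 : Matrix m m R[X]) + (X : R[X]) • N.map C).det = C (δ ^ Fintype.card m) := by
  set F := C δ • (1 : Matrix m m R[X]) + (X : R[X]) • N.map C with hF
  set G := C δ • (1 : Matrix m m R[X]) - (X : R[X]) • N.map C with hG
  have hNN : N.map (C : R → R[X]) * N.map C = 0 := by
    rw [← Matrix.map_mul, hN]; ext; simp
  have hNt : (N.map (C : R → R[X])).trace = 0 := by
    rw [← AddMonoidHom.map_trace (C : R →+* R[X]), ht]; simp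
  have hFG : F * G = (C (δ ^ 2)) • (1 : Matrix m m R[X]) := by
    rw [hF, hG]
    simp only [add_mul, mul_sub, smul_mul_assoc, mul_smul_comm, one_mul, mul_one, hNN, smul_zero,
      smul_add, C_pow]
    module
  have hadj : (C (δ ^ 2)) • F.adjugate = F.det • G := by
    calc _ = F.adjugate * (F * G) := by rw [hFG]; simp
      _ = _ := by rw [← mul_assoc, adjugate_mul]; simp
  have hd : F.map derivative = N.map C := by
    ext i j : 1
    by_cases h : i = j <;> simp [hF, h]
  have hder : derivative F.det = 0 := by
    have h1 : C (δ ^ 2) * derivative F.det = 0 := by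
      rw [derivative_det_eq_trace, hd, ← smul_eq_mul, ← trace_smul, ← smul_mul_assoc, hadj, hG,
        smul_mul_assoc, sub_mul, smul_mul_assoc, smul_mul_assoc, one_mul, hNN]
      simp [hNt]
    ext k
    have := congrArg (fun r => coeff r k) h1
    rw [coeff_C_mul, coeff_zero] at this
    rw [coeff_zero]
    exact (hδ.pow 2).left (by simpa using this)
  obtain ⟨c, hc⟩ : ∃ c, F.det = C c :=
    ⟨_, eq_C_of_natDegree_eq_zero (derivative_eq_zero.1 hder)⟩
  rw [hc]
  congr 1
  have h0 := congrArg (evalRingHom 0) hc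
  rw [RingHom.map_det] at h0
  have : (evalRingHom 0).mapMatrix F = δ • (1 : Matrix m m R) := by
    ext i j
    by_cases h : i = j <;> simp [hF, h]
  rw [this] at h0
  simpa using h0.symm

omit [DecidableEq m] in
theorem Matrix.IsSymm.trace_mul_eq_zero [IsAddTorsionFree R] {A B : Matrix m m R}
    (hA : A.IsSymm) (hB : Bᵀ = -B) : (A * B).trace = 0 := by
  have h : (A * B).trace = -(A * B).trace := by
    conv_lhs => rw [← trace_transpose, transpose_mul, hB, hA.eq, neg_mul, trace_neg, trace_mul_comm]
  exact self_eq_neg.1 h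

omit [DecidableEq m] in
/-- `B i j * B k l = B j k * B i l` holds for `B i j = b i * b j` with anticommuting `b`. -/
theorem Matrix.mul_mul_self_of_entries {B : Matrix m m R} (hB : Bᵀ = -B)
    (hq : ∀ i j k l, B i j * B k l = B j k * B i l) (A : Matrix m m R) :
    B * A * B = -(A * B).trace • B := by
  ext i l
  have hB' : ∀ j k, B j k = - B k j := fun j k => by
    rw [← transpose_apply B, hB, neg_apply]
  simp only [mul_apply, Matrix.smul_apply, trace, diag, smul_eq_mul, Finset.sum_mul, neg_mul,
    ← Finset.sum_neg_distrib]
  rw [Finset.sum_comm]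
  refine Finset.sum_congr rfl fun j _ => Finset.sum_congr rfl fun k _ => ?_
  rw [mul_right_comm, hq, hB' j k]
  ring

theorem Matrix.natDegree_det_le_of_isRegular [IsAddTorsionFree R] (J : Matrix m m R)
    {A B : Matrix m m R} (hA : A.IsSymm) (hB : Bᵀ = -B)
    (hq : ∀ i j k l, B i j * B k l = B j k * B i l) (hreg : IsRegular A.det) :
    (1 - (X : R[X]) • (J * A).map C - (X ^ 2 : R[X]) • (J * B).map C).det.natDegree
      ≤ Fintype.card m := by
  set M := (1 - (X : R[X]) • (J * A).map C - (X ^ 2 : R[X]) • (J * B).map C)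
  set δ := A.det
  set N := B * A.adjugate
  have htr : (A.adjugate * B).trace = 0 := hA.adjugate.trace_mul_eq_zero hB
  have hBKB : B * A.adjugate * B = 0 := by
    rw [mul_mul_self_of_entries hB hq, htr]; simp
  have hNN : N * N = 0 := by
    rw [← mul_assoc, hBKB, zero_mul]
  have hNA : N * A = δ • B := by
    rw [mul_assoc, adjugate_mul]; simp [δ]
  have hdet := det_C_smul_one_add_X_smul_of_sq_eq_zero hreg hNN
    (by rw [trace_mul_comm]; exact htr)
  have hCreg : IsRegular (C δ) := ⟨fun p q h => by
      ext k; exact hreg.left (by simpa using congrArg (fun r => coeff r k) h), fun p q h => by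
      ext k; exact hreg.right (by simpa using congrArg (fun r => coeff r k) h)⟩
  have hAB : (A.map C + (X : R[X]) • B.map C).det = C δ := by
    have h1 : (C δ • (1 : Matrix m m R[X]) + (X : R[X]) • N.map C) * A.map C
        = C δ • (A.map C + (X : R[X]) • B.map C) := by
      rw [add_mul, smul_mul_assoc, smul_mul_assoc, one_mul, ← Matrix.map_mul, hNA, smul_add,
        smul_comm]
      congr 2
      ext; simp
    have h2 := congrArg det h1
    rw [det_mul, hdet, det_smul, ← RingHom.mapMatrix_apply, ← RingHom.map_det, C_pow] at h2
    exact ((hCreg.pow _).left h2).symm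
  have hfac : (C δ • (1 : Matrix m m R[X]) - (X : R[X]) • (δ • (A * J) + N).map C)
      * (A.map C + (X : R[X]) • B.map C) = C δ • (A.map C * M) := by
    have e1 : (δ • (A * J) + N).map C * A.map C = C δ • ((A * J * A).map C + B.map C) := by
      rw [← Matrix.map_mul, add_mul, hNA, smul_mul_assoc]
      ext i j : 1
      rw [map_apply, add_apply, smul_apply, smul_apply, smul_apply, add_apply, map_apply, map_apply]
      simp [mul_add]
    have e2 : (δ • (A * J) + N).map C * B.map C = C δ • (A * J * B).map C := by
      rw [← Matrix.map_mul, add_mul, hBKB, smul_mul_assoc, add_zero]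
      ext i j : 1
      rw [map_apply, smul_apply, smul_apply, map_apply]
      simp
    have e3 : A.map C * M = A.map C - (X : R[X]) • (A * J * A).map C
        - (X ^ 2 : R[X]) • (A * J * B).map C := by
      simp only [M, mul_sub, mul_one, mul_smul_comm, mul_assoc, Matrix.map_mul]
    rw [e3, sub_mul, smul_mul_assoc, smul_mul_assoc, one_mul, mul_add, e1, mul_smul_comm, e2]
    module
  have hd := congrArg det hfac
  rw [det_mul, hAB, det_smul, det_mul, ← RingHom.mapMatrix_apply C A, ← RingHom.map_det,
    mul_comm (C A.det) M.det, ← mul_assoc] at hd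
  have hd' := hCreg.right hd
  have hle : (C δ • (1 : Matrix m m R[X]) - (X : R[X]) • (δ • (A * J) + N).map C).det.natDegree
      ≤ Fintype.card m := by
    convert natDegree_det_X_add_C_le (-(δ • (A * J) + N)) (δ • (1 : Matrix m m R)) using 3
    ext i j : 1
    by_cases h : i = j <;> simp [h] <;> ring
  rw [hd', ← C_pow] at hle
  rw [natDegree_le_iff_coeff_eq_zero] at hle ⊢
  intro k hk
  have := hle k hk
  rw [coeff_C_mul] at this
  exact (hreg.pow _).left (by simpa using this)

theorem Matrix.natDegree_det_one_sub_le [IsAddTorsionFree R] (J : Matrix m m R)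
    {A B : Matrix m m R} (hA : A.IsSymm) (hB : Bᵀ = -B)
    (hq : ∀ i j k l, B i j * B k l = B j k * B i l) :
    (1 - (X : R[X]) • (J * A).map C - (X ^ 2 : R[X]) • (J * B).map C).det.natDegree
      ≤ Fintype.card m := by
  have := Polynomial.isAddTorsionFree (R := R)
  have hreg : IsRegular (A.map C + (X : R[X]) • (1 : Matrix m m R[X])).det := by
    have : (A.map C + (X : R[X]) • (1 : Matrix m m R[X])) = charmatrix (-A) := by
      ext i j : 1
      by_cases h : i = j <;> simp [h, charmatrix, add_comm]
    rw [this]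
    exact (charpoly_monic (-A)).isRegular
  have key := natDegree_det_le_of_isRegular (R := R[X]) (J.map C)
    (A := A.map C + (X : R[X]) • (1 : Matrix m m R[X])) (B := B.map C)
    (by rw [IsSymm, transpose_add, transpose_smul, transpose_one, ← transpose_map, hA.eq])
    (by rw [← transpose_map, hB]; ext; simp)
    (fun i j k l => by simp only [map_apply, ← C_mul, hq i j k l])
    hreg
  refine le_trans ?_ (le_trans (natDegree_map_le (f := evalRingHom (0 : R))) key)
  apply le_of_eq
  rw [← coe_mapRingHom, RingHom.map_det]
  have hev : ∀ U : Matrix m m R, (U.map C).map (evalRingHom (0 : R)) = U := fun U => by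
    ext; simp
  have h1 : (J.map C * (A.map C + (X : R[X]) • (1 : Matrix m m R[X]))).map (evalRingHom (0 : R))
      = J * A := by
    rw [Matrix.map_mul, hev]
    congr 1
    ext i j
    by_cases h : i = j <;> simp [h]
  have h2 : (J.map C * B.map C).map (evalRingHom (0 : R)) = J * B := by
    rw [Matrix.map_mul, hev, hev]
  congr 2
  ext i j : 1
  rw [RingHom.mapMatrix_apply, map_apply]
  simp only [sub_apply, smul_apply, map_apply, smul_eq_mul, map_sub, map_mul, map_pow, ← h1, ← h2]
  rcases eq_or_ne i j with rfl | h
  · simp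
  · simp [h]
end DetDegree

section Newton
open Polynomial
variable {m : Type*} [Fintype m] [DecidableEq m] {R : Type*} [CommRing R]

/-- Shifted coefficients of the power series `(1 - t D - t² E)⁻¹`. -/
def resolventCoeff (D E : Matrix m m R) : ℕ → Matrix m m R
  | 0 => 0
  | 1 => 1
  | k + 2 => resolventCoeff D E (k + 1) * D + resolventCoeff D E k * E

theorem resolventCoeff_add_two (D E : Matrix m m R) (k : ℕ) :
    resolventCoeff D E (k + 2) = resolventCoeff D E (k + 1) * D + resolventCoeff D E k * E := rfl

theorem newton_resolventCoeff (D E : Matrix m m R) (k : ℕ) :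
    (k + 1) * (1 - (X : R[X]) • D.map C - (X ^ 2 : R[X]) • E.map C).det.coeff (k + 1) =
      -∑ p ∈ Finset.HasAntidiagonal.antidiagonal k,
        (1 - (X : R[X]) • D.map C - (X ^ 2 : R[X]) • E.map C).det.coeff p.1 *
          ((resolventCoeff D E (p.2 + 2)).trace + (resolventCoeff D E p.2 * E).trace) := by
  set M := (1 - (X : R[X]) • D.map C - (X ^ 2 : R[X]) • E.map C) with hM
  let T : R[X] →+* PowerSeries R := coeToPowerSeries.ringHom
  let H : Matrix m m (PowerSeries R) :=
    Matrix.of fun i j => PowerSeries.mk fun k => resolventCoeff D E (k + 1) i j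
  have hC : ∀ U : Matrix m m R, (U.map C).map T = U.map (PowerSeries.C (R := R)) := fun U => by
    ext; simp [T]
  have hMT : T.mapMatrix M = 1 - (PowerSeries.X : PowerSeries R) • D.map (PowerSeries.C (R := R))
      - (PowerSeries.X ^ 2 : PowerSeries R) • E.map (PowerSeries.C (R := R)) := by
    rw [hM, map_sub, map_sub, map_one, ← hC, ← hC]
    congr 2 <;> ext i j : 1
    · simp [T, mul_comm (PowerSeries.C _)]
    · simp [T, mul_comm (PowerSeries.C _)]
  have hcoeff : ∀ (U : Matrix m m R) (i j : m) (k : ℕ),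
      PowerSeries.coeff k ((H * U.map (PowerSeries.C (R := R))) i j)
        = (resolventCoeff D E (k + 1) * U) i j := fun U i j k => by
    simp [mul_apply, H]
  have hHM : H * T.mapMatrix M = 1 := by
    rw [hMT, mul_sub, mul_sub, mul_one, mul_smul_comm, mul_smul_comm]
    ext i j k
    have h1 : PowerSeries.coeff k ((1 : Matrix m m (PowerSeries R)) i j)
        = if k = 0 then (1 : Matrix m m R) i j else 0 := by
      rw [one_apply, one_apply]
      split_ifs <;> simp_all [PowerSeries.coeff_one]
    rw [h1, Matrix.sub_apply, Matrix.sub_apply, Matrix.smul_apply, Matrix.smul_apply, smul_eq_mul,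
      smul_eq_mul, map_sub, map_sub]
    rcases k with _ | _ | k
    · simp [H, resolventCoeff, pow_two, mul_assoc]
    · rw [PowerSeries.coeff_succ_X_mul, hcoeff, pow_two, mul_assoc, PowerSeries.coeff_succ_X_mul]
      simp [H, resolventCoeff]
    · rw [PowerSeries.coeff_succ_X_mul, hcoeff, pow_two, mul_assoc, PowerSeries.coeff_succ_X_mul,
        PowerSeries.coeff_succ_X_mul, hcoeff]
      simp [H, resolventCoeff_add_two]
  have hadj : T.mapMatrix M.adjugate = T M.det • H := by
    calc _ = H * T.mapMatrix M * T.mapMatrix M.adjugate := by rw [hHM, one_mul]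
      _ = _ := by
        rw [mul_assoc, ← map_mul, mul_adjugate]
        ext i j : 1
        simp [mul_apply, one_apply, apply_ite, mul_comm]
  have hder : T (derivative M.det) = - (T M.det *
      (H * (D.map (PowerSeries.C (R := R)) +
        (2 * PowerSeries.X : PowerSeries R) • E.map (PowerSeries.C (R := R)))).trace) := by
    have hd : T.mapMatrix (M.map derivative) = -(D.map (PowerSeries.C (R := R)) +
        (2 * PowerSeries.X : PowerSeries R) • E.map (PowerSeries.C (R := R))) := by
      ext i j : 1
      rcases eq_or_ne i j with rfl | h
      · simp [hM, T]; ring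
      · simp [hM, T, h]; ring
    have ht : ∀ U : Matrix m m R[X], T U.trace = (T.mapMatrix U).trace := fun U => by
      simp [trace]
    rw [derivative_det_eq_trace, ht, map_mul, hadj, hd, mul_neg, trace_neg, smul_mul_assoc,
      trace_smul, smul_eq_mul]
  have hk := congrArg (PowerSeries.coeff k) hder
  have hP : ∀ l, PowerSeries.coeff l ((H * (D.map (PowerSeries.C (R := R)) +
        (2 * PowerSeries.X : PowerSeries R) • E.map (PowerSeries.C (R := R)))).trace)
      = (resolventCoeff D E (l + 2)).trace + (resolventCoeff D E l * E).trace := by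
    intro l
    rw [mul_add, mul_smul_comm, trace_add, trace_smul, map_add]
    have h1 : ∀ (U : Matrix m m R) (k : ℕ), PowerSeries.coeff k
        (H * U.map (PowerSeries.C (R := R))).trace = (resolventCoeff D E (k + 1) * U).trace :=
      fun U k => by simp [trace, hcoeff]
    rw [h1, smul_eq_mul, mul_assoc, two_mul, map_add]
    rcases l with _ | l
    · simp [resolventCoeff]
    · rw [PowerSeries.coeff_succ_X_mul, h1, resolventCoeff_add_two D E (l + 1), trace_add]
      ring
  rw [map_neg, PowerSeries.coeff_mul] at hk
  simp only [hP, T, coeToPowerSeries.ringHom_apply, coeff_coe, coeff_derivative] at hk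
  rw [mul_comm, hk]

theorem trace_resolventCoeff_eq_zero [IsAddTorsionFree R] (D E : Matrix m m R) {d : ℕ}
    (hdeg : (1 - (X : R[X]) • D.map C - (X ^ 2 : R[X]) • E.map C).det.natDegree ≤ d)
    (hs : ∀ i j, ((resolventCoeff D E (i + 2)).trace + (resolventCoeff D E i * E).trace) *
      ((resolventCoeff D E (j + 2)).trace + (resolventCoeff D E j * E).trace) = 0)
    {k : ℕ} (hk : d ≤ k) :
    (resolventCoeff D E (k + 2)).trace + (resolventCoeff D E k * E).trace = 0 := by
  have hN := newton_resolventCoeff D E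
  set q := (1 - (X : R[X]) • D.map C - (X ^ 2 : R[X]) • E.map C).det with hq
  have q0 : q.coeff 0 = 1 := by
    rw [coeff_zero_eq_eval_zero, ← coe_evalRingHom, hq, RingHom.map_det]
    have : (evalRingHom (0 : R)).mapMatrix
        (1 - (X : R[X]) • D.map C - (X ^ 2 : R[X]) • E.map C) = 1 := by
      ext i j
      rcases eq_or_ne i j with rfl | h
      · simp
      · simp [h]
    rw [this, det_one]
  generalize hS : (fun k => (resolventCoeff D E (k + 2)).trace + (resolventCoeff D E k * E).trace)
    = s at *
  have hs' : ∀ i j, s i * s j = 0 := fun i j => by rw [← hS]; exact hs i j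
  have hN' : ∀ k : ℕ, (k + 1) * q.coeff (k + 1) =
      -∑ p ∈ Finset.HasAntidiagonal.antidiagonal k, q.coeff p.1 * s p.2 := fun k => by
    rw [← hS]; exact hN k
  have hmain : ∀ k : ℕ, (∀ i ≤ k, ∀ j, q.coeff (i + 1) * s j = 0) ∧
      (k + 1) * q.coeff (k + 1) = - s k := by
    intro k
    induction k using Nat.strong_induction_on with
    | _ k ih =>
      have h1 : (k + 1) * q.coeff (k + 1) = - s k := by
        rw [hN', Finset.sum_eq_single (0, k)]
        · simp [q0]
        · rintro ⟨_ | a, b⟩ hab hne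
          · simp at hab; simp [hab] at hne
          · simp only [Finset.HasAntidiagonal.mem_antidiagonal] at hab
            exact (ih a (by omega)).1 a le_rfl b
        · simp
      refine ⟨fun i hi j => ?_, h1⟩
      rcases hi.lt_or_eq with h | rfl
      · exact (ih i h).1 i le_rfl j
      · have h2 : (i + 1) • (q.coeff (i + 1) * s j) = 0 := by
          rw [nsmul_eq_mul, ← mul_assoc]
          push_cast
          rw [h1, neg_mul, hs', neg_zero]
        exact (smul_eq_zero_iff_right (Nat.succ_ne_zero i)).1 h2
  have h3 := (hmain k).2
  rw [coeff_eq_zero_of_natDegree_lt (by omega), mul_zero] at h3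
  have h4 : s k = 0 := by rw [← neg_eq_zero, ← h3]
  rw [← h4, ← hS]
end Newton

section SuperTrace
variable {l m : Type*} [Fintype l] [Fintype m]

/-- The supertrace of a matrix on a graded index set `l ⊕ m`. -/
def Matrix.superTrace {S : Type*} [AddCommGroup S] (M : Matrix (l ⊕ m) (l ⊕ m) S) : S :=
  M.toBlocks₁₁.trace - M.toBlocks₂₂.trace

omit [Fintype l] in
theorem Matrix.transpose_mul_of_commute {k : Type*} {S : Type*} [NonUnitalNonAssocSemiring S]
    {U : Matrix k m S} {V : Matrix m l S} (h : ∀ i j t, U i j * V j t = V j t * U i j) :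
    (U * V)ᵀ = Vᵀ * Uᵀ := by
  ext t i
  simp [mul_apply, h]

omit [Fintype l] in
theorem Matrix.transpose_mul_of_anticommute {k : Type*} {S : Type*} [NonUnitalNonAssocRing S]
    {U : Matrix k m S} {V : Matrix m l S} (h : ∀ i j t, U i j * V j t = -(V j t * U i j)) :
    (U * V)ᵀ = -(Vᵀ * Uᵀ) := by
  ext t i
  simp [mul_apply, h]

variable [DecidableEq m] {A S : Type*} [CommRing A] [Ring S]

theorem exists_pow_eq_fromBlocks (ι : A →+* S) (J D B : Matrix m m A) (r : Matrix (Fin 1) m S)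
    (hB : rᵀ * r = B.map ι) (k : ℕ) :
    ∃ P Q, (fromBlocks 0 r (J.map ι * rᵀ) ((J * D).map ι)) ^ k =
      fromBlocks P Q ((resolventCoeff (J * D) (J * B) k * J).map ι * rᵀ)
        ((resolventCoeff (J * D) (J * B) (k + 1)).map ι) := by
  induction k with
  | zero => exact ⟨1, 0, by simp [resolventCoeff, ← fromBlocks_one]⟩
  | succ k ih =>
    obtain ⟨P, Q, h⟩ := ih
    refine ⟨P * 0 + Q * (J.map ι * rᵀ), P * r + Q * (J * D).map ι, ?_⟩
    rw [pow_succ, h, fromBlocks_multiply]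
    congr 1
    · rw [Matrix.mul_zero, zero_add, ← Matrix.mul_assoc, ← Matrix.map_mul]
    · rw [Matrix.mul_assoc, hB, ← Matrix.map_mul, ← Matrix.map_mul, resolventCoeff_add_two,
        add_comm, Matrix.mul_assoc (resolventCoeff _ _ k)]
      ext i j
      simp only [Matrix.add_apply, map_apply, map_add]

theorem superTrace_pow_succ (ι : A →+* S) (J D B : Matrix m m A) (r : Matrix (Fin 1) m S)
    (hB : rᵀ * r = B.map ι) (hBt : Bᵀ = -B) (hr : ∀ a i j, ι a * r i j = r i j * ι a) (k : ℕ) :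
    ((fromBlocks 0 r (J.map ι * rᵀ) ((J * D).map ι)) ^ (k + 1)).superTrace =
      -ι ((resolventCoeff (J * D) (J * B) (k + 2)).trace +
        (resolventCoeff (J * D) (J * B) k * (J * B)).trace) := by
  obtain ⟨P, Q, h⟩ := exists_pow_eq_fromBlocks ι J D B r hB k
  obtain ⟨P', Q', h'⟩ := exists_pow_eq_fromBlocks ι J D B r hB (k + 1)
  have hP : P' = r * ((resolventCoeff (J * D) (J * B) k * J).map ι * rᵀ) := by
    have := h'
    rw [pow_succ', h, fromBlocks_multiply, fromBlocks_inj] at this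
    rw [← this.1, Matrix.zero_mul, zero_add]
  have hB' : ∀ i j, r 0 i * r 0 j = ι (B i j) := fun i j => by
    simpa [mul_apply] using congrFun (congrFun hB i) j
  have hc : P'.trace = -ι (resolventCoeff (J * D) (J * B) k * (J * B)).trace := by
    rw [hP, ← Matrix.mul_assoc (resolventCoeff _ _ k)]
    generalize resolventCoeff (J * D) (J * B) k * J = U
    have hBt' : ∀ i j, B j i = - B i j := fun i j => by
      rw [← transpose_apply B, hBt, neg_apply]
    simp only [trace, diag, mul_apply, Finset.univ_unique, Finset.sum_singleton, map_sum,
      Fin.default_eq_zero, map_apply, transpose_apply, Finset.mul_sum, ← Finset.sum_neg_distrib]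
    refine Finset.sum_congr rfl fun i _ => Finset.sum_congr rfl fun j _ => ?_
    rw [← mul_assoc, ← hr, mul_assoc, hB', ← map_mul, hBt' i j, mul_neg, map_neg, neg_neg]
  have hd : ((resolventCoeff (J * D) (J * B) (k + 1 + 1)).map ι).trace =
      ι (resolventCoeff (J * D) (J * B) (k + 2)).trace := by
    simp [trace]
  rw [h', superTrace, toBlocks_fromBlocks₁₁, toBlocks_fromBlocks₂₂, hc, hd, map_add]
  abel

theorem superTrace_pow_succ_eq_zero [IsAddTorsionFree A] (ι : A →+* S)
    (hι : Function.Injective ι) (J : Matrix m m A) {D B : Matrix m m A} (hD : D.IsSymm)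
    (r : Matrix (Fin 1) m S) (hB : rᵀ * r = B.map ι)
    (hrr : ∀ i j, r 0 i * r 0 j = -(r 0 j * r 0 i)) (hr : ∀ a i j, ι a * r i j = r i j * ι a)
    (hs : ∀ i j, ((fromBlocks 0 r (J.map ι * rᵀ) ((J * D).map ι)) ^ (i + 1)).superTrace *
      ((fromBlocks 0 r (J.map ι * rᵀ) ((J * D).map ι)) ^ (j + 1)).superTrace = 0)
    {k : ℕ} (hk : Fintype.card m ≤ k) :
    ((fromBlocks 0 r (J.map ι * rᵀ) ((J * D).map ι)) ^ (k + 1)).superTrace = 0 := by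
  have hB' : ∀ i j, ι (B i j) = r 0 i * r 0 j := fun i j => by
    simpa [mul_apply] using (congrFun (congrFun hB i) j).symm
  have hBt : Bᵀ = -B := by
    ext i j
    apply hι
    rw [transpose_apply, neg_apply, map_neg, hB', hB', hrr]
  have hq : ∀ i j k l, B i j * B k l = B j k * B i l := fun i j k l => by
    apply hι
    calc ι (B i j * B k l) = r 0 i * (r 0 j * r 0 k) * r 0 l := by
          rw [map_mul, hB' i j, hB' k l]; simp only [mul_assoc]
      _ = ι (B j k * B i l) := by
          rw [← hB', ← hr, mul_assoc, ← hB', map_mul]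
  simp only [superTrace_pow_succ ι J D B r hB hBt hr] at hs ⊢
  rw [trace_resolventCoeff_eq_zero _ _ (natDegree_det_one_sub_le J hD hBt hq) ?_ hk, map_zero,
    neg_zero]
  intro i j
  apply hι
  rw [map_mul, map_zero, ← neg_mul_neg, hs]
end SuperTrace

section Color
variable {S : Type*} [Ring S] [Algebra ℂ S]

/-- Elements supercommuting with factor `u` past `gO` and with factor `v` past `gE`. -/
def colorSubmodule (gO gE : Set S) (u v : ℂ) : Submodule ℂ S where
  carrier := {s | (∀ x ∈ gO, s * x = u • (x * s)) ∧ ∀ y ∈ gE, s * y = v • (y * s)}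
  zero_mem' := by simp
  add_mem' := by
    rintro s t ⟨hs, hs'⟩ ⟨ht, ht'⟩
    refine ⟨fun x hx => ?_, fun y hy => ?_⟩
    · rw [add_mul, mul_add, hs x hx, ht x hx, smul_add]
    · rw [add_mul, mul_add, hs' y hy, ht' y hy, smul_add]
  smul_mem' := by
    rintro c s ⟨hs, hs'⟩
    refine ⟨fun x hx => ?_, fun y hy => ?_⟩
    · rw [smul_mul_assoc, mul_smul_comm, hs x hx, smul_comm]
    · rw [smul_mul_assoc, mul_smul_comm, hs' y hy, smul_comm]

variable {gO gE : Set S} {u v u' v' : ℂ} {s t : S}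

theorem mul_mem_colorSubmodule (hs : s ∈ colorSubmodule gO gE u v)
    (ht : t ∈ colorSubmodule gO gE u' v') : s * t ∈ colorSubmodule gO gE (u * u') (v * v') := by
  refine ⟨fun x hx => ?_, fun y hy => ?_⟩
  · rw [mul_assoc, ht.1 x hx, mul_smul_comm, ← mul_assoc, hs.1 x hx, smul_mul_assoc, smul_smul,
      mul_assoc, mul_comm u']
  · rw [mul_assoc, ht.2 y hy, mul_smul_comm, ← mul_assoc, hs.2 y hy, smul_mul_assoc, smul_smul,
      mul_assoc, mul_comm v']

theorem mul_eq_smul_of_mem_span {g : Set S} {c : ℂ} (h : ∀ x ∈ g, s * x = c • (x * s))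
    (ht : t ∈ Submodule.span ℂ g) : s * t = c • (t * s) := by
  induction ht using Submodule.span_induction with
  | mem x hx => exact h x hx
  | zero => simp
  | add x y _ _ hx hy => rw [mul_add, hx, hy, add_mul, smul_add]
  | smul a x _ hx => rw [mul_smul_comm, hx, smul_mul_assoc, smul_comm]

theorem mul_eq_smul_of_mem_span_odd (hs : s ∈ colorSubmodule gO gE u v)
    (ht : t ∈ Submodule.span ℂ gO) : s * t = u • (t * s) :=
  mul_eq_smul_of_mem_span hs.1 ht

theorem mul_eq_smul_of_mem_span_even (hs : s ∈ colorSubmodule gO gE u v)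
    (ht : t ∈ Submodule.span ℂ gE) : s * t = v • (t * s) :=
  mul_eq_smul_of_mem_span hs.2 ht

/-- Twisted supercommutation: `gO` commutes, `gE` anticommutes, and `gO` anticommutes with `gE`. -/
structure IsTwistedSupercommuting (gO gE : Set S) : Prop where
  oo : ∀ x ∈ gO, ∀ y ∈ gO, x * y = y * x
  oe : ∀ x ∈ gO, ∀ y ∈ gE, x * y = -(y * x)
  ee : ∀ x ∈ gE, ∀ y ∈ gE, x * y = -(y * x)

namespace IsTwistedSupercommuting
variable (h : IsTwistedSupercommuting gO gE)
include h

theorem span_odd_le : Submodule.span ℂ gO ≤ colorSubmodule gO gE 1 (-1) :=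
  Submodule.span_le.2 fun x hx => ⟨fun y hy => by rw [one_smul, h.oo x hx y hy],
    fun y hy => by rw [neg_one_smul, h.oe x hx y hy]⟩

theorem span_even_le : Submodule.span ℂ gE ≤ colorSubmodule gO gE (-1) (-1) :=
  Submodule.span_le.2 fun x hx => ⟨fun y hy => by rw [neg_one_smul, h.oe y hy x hx, neg_neg],
    fun y hy => by rw [neg_one_smul, h.ee x hx y hy]⟩

end IsTwistedSupercommuting
end Color

theorem sq_add_mul_pow {R : Type*} [Ring R] {X Θ : R} (hX : X * Θ = -(Θ * X)) (hΘ : Θ * Θ = 0)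
    (k : ℕ) : (X ^ 2 + Θ * X) ^ (k + 1) = X ^ (2 * k + 2) + (k + 1) • (Θ * X ^ (2 * k + 1)) := by
  have hc : Commute (X ^ 2) Θ := by
    rw [Commute, SemiconjBy, pow_two, mul_assoc, hX, mul_neg, ← mul_assoc, hX]
    simp [mul_assoc]
  have h1 : ∀ k, X ^ (2 * k) * Θ = Θ * X ^ (2 * k) := fun k => by
    rw [pow_mul, (hc.pow_left k).eq]
  have h2 : ∀ k, Θ * X ^ (2 * k + 1) * (Θ * X) = 0 := fun k => by
    rw [pow_succ', mul_assoc, ← mul_assoc (X * _), mul_assoc X, h1, ← mul_assoc X, hX, neg_mul,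
      neg_mul, mul_neg, ← mul_assoc Θ, ← mul_assoc Θ, ← mul_assoc Θ, hΘ]
    simp
  induction k with
  | zero => simp
  | succ k ih =>
    have h3 : X ^ (2 * k + 2) * (Θ * X) = Θ * X ^ (2 * k + 3) := by
      rw [← mul_assoc, show 2 * k + 2 = 2 * (k + 1) by ring, h1, mul_assoc, ← pow_succ,
        show 2 * (k + 1) + 1 = 2 * k + 3 by ring]
    rw [pow_succ, ih, add_mul, mul_add, mul_add, h3, smul_mul_assoc, smul_mul_assoc, h2,
      mul_assoc, ← pow_add, ← pow_add, smul_zero, add_zero, succ_nsmul (Θ * _) (k + 1),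
      show 2 * (k + 1) + 1 = 2 * k + 3 by ring, show 2 * (k + 1) + 2 = 2 * k + 2 + 2 by ring,
      show 2 * k + 1 + 2 = 2 * k + 3 by ring]
    abel

theorem IsAddTorsionFree.of_module_complex (M : Type*) [AddCommGroup M] [Module ℂ M] :
    IsAddTorsionFree M := by
  let _ := Module.compHom M (algebraMap ℚ ℂ)
  exact IsAddTorsionFree.of_module_rat M

section GenericSuperMatrix
variable {S : Type*} [Ring S] [Algebra ℂ S] {l m : Type*} [Fintype l] [Fintype m]

/-- The sign `(-1)^|a|` of an index `a` of `l ⊕ m`. -/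
def gradeSign : l ⊕ m → ℂ := Sum.elim (fun _ => 1) fun _ => -1

omit [Fintype l] [Fintype m] in
theorem gradeSign_mul_self (a : l ⊕ m) : gradeSign a * gradeSign a = 1 := by
  cases a <;> simp [gradeSign]

theorem Matrix.superTrace_eq_sum (M : Matrix (l ⊕ m) (l ⊕ m) S) :
    M.superTrace = ∑ a, gradeSign a • M a a := by
  simp [superTrace, trace, gradeSign, sub_eq_add_neg, toBlocks₁₁, toBlocks₂₂]

/-- Entries of even blocks lie in the span of `gE`, entries of odd blocks in the span of `gO`. -/
def IsGenericSuperMatrix (gO gE : Set S) (X : Matrix (l ⊕ m) (l ⊕ m) S) : Prop :=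
  ∀ a b, (gradeSign a * gradeSign b = -1 ∧ X a b ∈ Submodule.span ℂ gO) ∨
    (gradeSign a * gradeSign b = 1 ∧ X a b ∈ Submodule.span ℂ gE)

variable {gO gE : Set S} {X : Matrix (l ⊕ m) (l ⊕ m) S}
  (h : IsTwistedSupercommuting gO gE) (hX : IsGenericSuperMatrix gO gE X)

omit [Fintype l] [Fintype m] in
include h hX in
theorem IsGenericSuperMatrix.apply_mem (a b : l ⊕ m) :
    X a b ∈ colorSubmodule gO gE (-(gradeSign a * gradeSign b)) (-1) := by
  rcases hX a b with ⟨h1, h2⟩ | ⟨h1, h2⟩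
  · rw [h1, neg_neg]
    exact h.span_odd_le h2
  · rw [h1]
    exact h.span_even_le h2

variable [DecidableEq l] [DecidableEq m]

include h hX in
theorem IsGenericSuperMatrix.pow_apply_mem (k : ℕ) (a b : l ⊕ m) :
    (X ^ k) a b ∈ colorSubmodule gO gE ((-1) ^ k * (gradeSign a * gradeSign b)) ((-1) ^ k) := by
  induction k generalizing b with
  | zero =>
    rcases eq_or_ne a b with rfl | hab
    · rw [gradeSign_mul_self, pow_zero X, pow_zero, one_apply_eq]
      exact ⟨fun x _ => by simp, fun y _ => by simp⟩
    · rw [pow_zero X, one_apply_ne hab]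
      exact Submodule.zero_mem _
  | succ k ih =>
    rw [pow_succ X, mul_apply]
    refine Submodule.sum_mem _ fun c _ => ?_
    have e : (-1) ^ (k + 1) * (gradeSign a * gradeSign b) = (-1) ^ k * (gradeSign a * gradeSign c) *
        -(gradeSign c * gradeSign b) := by
      linear_combination
        ((-1) ^ k * gradeSign a * gradeSign b) * gradeSign_mul_self (m := m) c
    rw [e, pow_succ (-1 : ℂ)]
    exact mul_mem_colorSubmodule (ih c) (hX.apply_mem h c b)

include h hX in
theorem IsGenericSuperMatrix.superTrace_pow_even (k : ℕ) : (X ^ (2 * k + 2)).superTrace = 0 := by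
  have hc : ∀ a c, (X ^ (2 * k + 1)) a c * X c a =
      -(gradeSign a * gradeSign c) • (X c a * (X ^ (2 * k + 1)) a c) := fun a c => by
    have h1 : (-1 : ℂ) ^ (2 * k + 1) = -1 := by rw [pow_succ, pow_mul]; simp
    have hM := hX.pow_apply_mem h (2 * k + 1) a c
    rw [h1] at hM
    rcases hX c a with ⟨h2, h3⟩ | ⟨h2, h3⟩
    · rw [mul_eq_smul_of_mem_span_odd hM h3, neg_one_mul]
    · rw [mul_eq_smul_of_mem_span_even hM h3, mul_comm (gradeSign a), h2]
  have h1 : (X ^ (2 * k + 2)).superTrace = -(X ^ (2 * k + 2)).superTrace := by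
    conv_lhs => rw [pow_succ]
    conv_rhs => rw [pow_succ']
    rw [superTrace_eq_sum, superTrace_eq_sum, ← Finset.sum_neg_distrib]
    simp only [mul_apply, Finset.smul_sum, ← Finset.sum_neg_distrib]
    rw [Finset.sum_comm]
    refine Finset.sum_congr rfl fun c _ => Finset.sum_congr rfl fun a _ => ?_
    rw [hc, smul_smul, ← neg_smul]
    congr 1
    linear_combination (-gradeSign c) * gradeSign_mul_self (m := m) a
  have := IsAddTorsionFree.of_module_complex S
  exact self_eq_neg.1 h1
end GenericSuperMatrix

section Vanishing
variable {S : Type*} [Ring S] [Algebra ℂ S] {gO gE : Set S}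

theorem exists_center_adjoin_eq {s : S} (hs : s ∈ colorSubmodule gO gE 1 1)
    (hs' : s ∈ Algebra.adjoin ℂ (gO ∪ gE)) :
    ∃ a : Subalgebra.center ℂ (Algebra.adjoin ℂ (gO ∪ gE)),
      ((a : Algebra.adjoin ℂ (gO ∪ gE)) : S) = s := by
  refine ⟨⟨⟨s, hs'⟩, Subalgebra.mem_center_iff.2 fun b => Subtype.ext ?_⟩, rfl⟩
  have : Algebra.adjoin ℂ (gO ∪ gE) ≤ Subalgebra.centralizer ℂ {s} := by
    refine Algebra.adjoin_le fun x hx => Subalgebra.mem_centralizer_iff ℂ |>.2 ?_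
    rintro _ rfl
    rcases hx with hx | hx
    · simpa using hs.1 x hx
    · simpa using hs.2 x hx
  exact ((Subalgebra.mem_centralizer_iff ℂ).1 (this b.2) s rfl).symm

variable {m : Type*} [Fintype m] [DecidableEq m]

omit [DecidableEq m] in
theorem Matrix.map_algebraMap_mul_smul {c : Type*} (J : Matrix m m ℂ) (θ : S) (U : Matrix m c S) :
    J.map (algebraMap ℂ S) * (θ • U) = θ • (J.map (algebraMap ℂ S) * U) := by
  ext i j
  simp only [mul_apply, Matrix.smul_apply, smul_eq_mul, Finset.mul_sum, map_apply]
  exact Finset.sum_congr rfl fun l _ => by rw [← mul_assoc, Algebra.commutes, mul_assoc]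

theorem mul_superTrace_pow_eq_zero (h : IsTwistedSupercommuting gO gE) {θ : S} (hθ : θ ∈ gE)
    {J : Matrix m m ℂ} (hJ : Jᵀ = -J) {x : Matrix (Fin 1) m S}
    (hx : ∀ i j, x i j ∈ Submodule.span ℂ gO) {Ω : Matrix m m S}
    (hΩ : ∀ i j, Ω i j ∈ Submodule.span ℂ gE) (hΩs : Ωᵀ = Ω) {k : ℕ} (hk : Fintype.card m ≤ k) :
    θ * ((fromBlocks 0 x (J.map (algebraMap ℂ S) * xᵀ) (J.map (algebraMap ℂ S) * Ω)) ^
      (2 * k + 1)).superTrace = 0 := by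
  have tfS := IsAddTorsionFree.of_module_complex S
  have hJs : ∀ i j (s : S), J.map (algebraMap ℂ S) i j * s = s * J.map (algebraMap ℂ S) i j :=
    fun i j s => Algebra.commutes _ _
  have hJt : (J.map (algebraMap ℂ S))ᵀ = -J.map (algebraMap ℂ S) := by
    rw [← transpose_map, hJ]; ext; simp
  set Jι := J.map (algebraMap ℂ S) with hJι
  set X := fromBlocks 0 x (Jι * xᵀ) (Jι * Ω) with hX
  have hJx : ∀ i j, (Jι * xᵀ) i j ∈ Submodule.span ℂ gO := fun i j => by
    rw [mul_apply]
    refine Submodule.sum_mem _ fun c _ => ?_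
    rw [hJι, map_apply, ← Algebra.smul_def]
    exact Submodule.smul_mem _ _ (hx _ _)
  have hJΩ : ∀ i j, (Jι * Ω) i j ∈ Submodule.span ℂ gE := fun i j => by
    rw [mul_apply]
    refine Submodule.sum_mem _ fun c _ => ?_
    rw [hJι, map_apply, ← Algebra.smul_def]
    exact Submodule.smul_mem _ _ (hΩ _ _)
  have hgen : IsGenericSuperMatrix gO gE X := by
    rintro (a | a) (b | b)
    · exact Or.inr (by simp [gradeSign, hX])
    · exact Or.inl (by simp [gradeSign, hX, hx])
    · exact Or.inl (by simpa [gradeSign, hX] using hJx a b)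
    · exact Or.inr (by simpa [gradeSign, hX] using hJΩ a b)
  have oo : ∀ {s t}, s ∈ Submodule.span ℂ gO → t ∈ Submodule.span ℂ gO → s * t = t * s :=
    fun hs ht => by simpa using mul_eq_smul_of_mem_span_odd (h.span_odd_le hs) ht
  have oe : ∀ {s t}, s ∈ Submodule.span ℂ gO → t ∈ Submodule.span ℂ gE → s * t = -(t * s) :=
    fun hs ht => by simpa using mul_eq_smul_of_mem_span_even (h.span_odd_le hs) ht
  have ee : ∀ {s t}, s ∈ Submodule.span ℂ gE → t ∈ Submodule.span ℂ gE → s * t = -(t * s) :=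
    fun hs ht => by simpa using mul_eq_smul_of_mem_span_even (h.span_even_le hs) ht
  have hθs := Submodule.subset_span (R := ℂ) hθ
  have hθθ : θ * θ = 0 := self_eq_neg.1 (ee hθs hθs)
  -- the matrix `Y = X² + θ X` in block form
  set b := x * (Jι * Ω) + θ • x with hb
  set T := xᵀ * x + Ω * (Jι * Ω) + θ • Ω with hT
  have hxJx : x * (Jι * xᵀ) = 0 := by
    have h1 : (x * (Jι * xᵀ))ᵀ = -(x * (Jι * xᵀ)) := by
      rw [transpose_mul_of_commute fun i j t => oo (hx i j) (hJx j t),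
        transpose_mul_of_commute fun i j t => hJs i j _, hJt, transpose_transpose,
        Matrix.mul_neg, Matrix.neg_mul, Matrix.mul_assoc]
    ext i j
    have h2 := congrFun (congrFun h1 i) j
    rw [Subsingleton.elim i j] at h2 ⊢
    exact self_eq_neg.1 h2
  have hJΩt : (Jι * Ω)ᵀ = -(Ω * Jι) := by
    rw [transpose_mul_of_commute fun i j t => hJs i j _, hJt, hΩs, Matrix.mul_neg]
  have hbt : bᵀ = Ω * (Jι * xᵀ) + θ • xᵀ := by
    rw [hb, transpose_add, transpose_mul_of_anticommute fun i j t => oe (hx i j) (hJΩ j t), hJΩt,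
      Matrix.neg_mul, neg_neg, transpose_smul, Matrix.mul_assoc]
  have hTs : Tᵀ = T := by
    rw [hT, transpose_add, transpose_add,
      transpose_mul_of_commute (U := xᵀ) fun i j t => oo (hx j i) (hx j t), transpose_transpose,
      transpose_mul_of_anticommute fun i j t => ee (hΩ i j) (hJΩ j t), hJΩt, transpose_smul, hΩs,
      Matrix.neg_mul, neg_neg, Matrix.mul_assoc]
  have hJθ : Jι * (θ • Ω) = θ • (Jι * Ω) := map_algebraMap_mul_smul J θ Ω
  have hJθ' : Jι * (θ • xᵀ) = θ • (Jι * xᵀ) := map_algebraMap_mul_smul J θ xᵀ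
  have hY : X ^ 2 + diagonal (fun _ => θ) * X = fromBlocks 0 b (Jι * bᵀ) (Jι * T) := by
    rw [← smul_eq_diagonal_mul, hX, pow_two, fromBlocks_multiply, fromBlocks_smul, fromBlocks_add,
      hbt, hb, hT]
    simp only [Matrix.mul_zero, Matrix.zero_mul, zero_add, add_zero, smul_zero, hxJx,
      Matrix.mul_add, hJθ, hJθ', Matrix.mul_assoc]
  -- colours of the blocks
  have hbK : ∀ i j, b i j ∈ colorSubmodule gO gE (-1) 1 := fun i j => by
    refine Submodule.add_mem _ ?_ ?_
    · rw [mul_apply]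
      refine Submodule.sum_mem _ fun c _ => ?_
      simpa using mul_mem_colorSubmodule (h.span_odd_le (hx i c)) (h.span_even_le (hJΩ c j))
    · simpa using mul_mem_colorSubmodule (h.span_even_le hθs) (h.span_odd_le (hx i j))
  have hTK : ∀ i j, T i j ∈ colorSubmodule gO gE 1 1 := fun i j => by
    refine Submodule.add_mem _ (Submodule.add_mem _ ?_ ?_) ?_
    · rw [mul_apply]
      refine Submodule.sum_mem _ fun c _ => ?_
      simpa using mul_mem_colorSubmodule (h.span_odd_le (hx c i)) (h.span_odd_le (hx c j))
    · rw [mul_apply]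
      refine Submodule.sum_mem _ fun c _ => ?_
      simpa using mul_mem_colorSubmodule (h.span_even_le (hΩ i c)) (h.span_even_le (hJΩ c j))
    · simpa using mul_mem_colorSubmodule (h.span_even_le hθs) (h.span_even_le (hΩ i j))
  have hOA : Submodule.span ℂ gO ≤ Subalgebra.toSubmodule (Algebra.adjoin ℂ (gO ∪ gE)) :=
    Submodule.span_le.2 fun x hx => Algebra.subset_adjoin (Or.inl hx)
  have hEA : Submodule.span ℂ gE ≤ Subalgebra.toSubmodule (Algebra.adjoin ℂ (gO ∪ gE)) :=
    Submodule.span_le.2 fun x hx => Algebra.subset_adjoin (Or.inr hx)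
  have hbA : ∀ i j, b i j ∈ Algebra.adjoin ℂ (gO ∪ gE) := fun i j => by
    refine add_mem ?_ (mul_mem (hEA hθs) (hOA (hx i j)))
    rw [mul_apply]
    exact sum_mem fun c _ => mul_mem (hOA (hx i c)) (hEA (hJΩ c j))
  have hTA : ∀ i j, T i j ∈ Algebra.adjoin ℂ (gO ∪ gE) := fun i j => by
    refine add_mem (add_mem ?_ ?_) (mul_mem (hEA hθs) (hEA (hΩ i j)))
    · rw [mul_apply]
      exact sum_mem fun c _ => mul_mem (hOA (hx c i)) (hOA (hx c j))
    · rw [mul_apply]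
      exact sum_mem fun c _ => mul_mem (hEA (hΩ i c)) (hEA (hJΩ c j))
  have hbb : ∀ i j, b 0 i * b 0 j = -(b 0 j * b 0 i) := fun i j => by
    have hO : Submodule.span ℂ gO ≤ colorSubmodule {b 0 i} ∅ (-1) 1 := Submodule.span_le.2
      fun x hx => ⟨fun y hy => by rw [Set.mem_singleton_iff.1 hy, (hbK 0 i).1 x hx]; simp,
        fun _ h => h.elim⟩
    have hE : Submodule.span ℂ gE ≤ colorSubmodule {b 0 i} ∅ 1 1 := Submodule.span_le.2
      fun x hx => ⟨fun y hy => by rw [Set.mem_singleton_iff.1 hy, (hbK 0 i).2 x hx]; simp,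
        fun _ h => h.elim⟩
    have h1 : b 0 j ∈ colorSubmodule {b 0 i} ∅ (-1) 1 := by
      refine Submodule.add_mem _ ?_ ?_
      · rw [mul_apply]
        refine Submodule.sum_mem _ fun c _ => ?_
        simpa using mul_mem_colorSubmodule (hO (hx 0 c)) (hE (hJΩ c j))
      · simpa using mul_mem_colorSubmodule (hE hθs) (hO (hx 0 j))
    rw [h1.1 _ rfl]
    simp
  -- traces of powers
  have hXΘ : X * diagonal (fun _ => θ) = -(diagonal (fun _ => θ) * X) := by
    ext a c
    rw [Matrix.neg_apply, mul_diagonal, diagonal_mul, (hgen.apply_mem h a c).2 θ hθ, neg_one_smul]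
  have hYtr : ∀ k : ℕ, ((X ^ 2 + diagonal (fun _ => θ) * X) ^ (k + 1)).superTrace =
      (k + 1) • (θ * (X ^ (2 * k + 1)).superTrace) := fun k => by
    have h1 := hgen.superTrace_pow_even h k
    rw [superTrace_eq_sum] at h1
    rw [sq_add_mul_pow hXΘ (by simp [hθθ]), superTrace_eq_sum, superTrace_eq_sum]
    simp only [Matrix.add_apply, Matrix.smul_apply, diagonal_mul, smul_add, Finset.sum_add_distrib,
      h1, zero_add, Finset.mul_sum, Finset.smul_sum, mul_smul_comm]
    exact Finset.sum_congr rfl fun a _ => smul_comm _ _ _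
  have hθX : ∀ k : ℕ, (X ^ (2 * k + 1)).superTrace * θ = -(θ * (X ^ (2 * k + 1)).superTrace) :=
    fun k => by
    have h1 : (-1 : ℂ) ^ (2 * k + 1) = -1 := by rw [pow_succ, pow_mul]; simp
    rw [superTrace_eq_sum, Finset.sum_mul, Finset.mul_sum, ← Finset.sum_neg_distrib]
    refine Finset.sum_congr rfl fun a _ => ?_
    rw [smul_mul_assoc, (hgen.pow_apply_mem h (2 * k + 1) a a).2 θ hθ, h1, mul_smul_comm,
      neg_one_smul, smul_neg]
  choose D hD using fun i j => exists_center_adjoin_eq (hTK i j) (hTA i j)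
  choose B hB using fun i j => exists_center_adjoin_eq (s := b 0 i * b 0 j)
    (by simpa using mul_mem_colorSubmodule (hbK 0 i) (hbK 0 j)) (mul_mem (hbA 0 i) (hbA 0 j))
  let ι : Subalgebra.center ℂ (Algebra.adjoin ℂ (gO ∪ gE)) →+* S :=
    (Algebra.adjoin ℂ (gO ∪ gE)).subtype.comp
      (Subalgebra.center ℂ (Algebra.adjoin ℂ (gO ∪ gE))).subtype
  have hι : Function.Injective ι := Subtype.val_injective.comp Subtype.val_injective
  have tfA := IsAddTorsionFree.of_module_complex
    (Subalgebra.center ℂ (Algebra.adjoin ℂ (gO ∪ gE)))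
  have hDι : (Matrix.of D).map ι = T := by ext i j; exact hD i j
  have hJι' : (J.map (algebraMap ℂ (Subalgebra.center ℂ (Algebra.adjoin ℂ (gO ∪ gE))))).map ι
    = Jι := rfl
  have hJD : (J.map (algebraMap ℂ (Subalgebra.center ℂ (Algebra.adjoin ℂ (gO ∪ gE)))) *
      Matrix.of D).map ι = Jι * T := by rw [Matrix.map_mul, hDι, hJι']
  have key := superTrace_pow_succ_eq_zero ι hι (J.map (algebraMap ℂ _)) (D := Matrix.of D)
    (B := Matrix.of B) ?_ b ?_ hbb ?_ ?_ hk
  · rw [hJD, hJι', ← hY, hYtr] at key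
    exact (smul_eq_zero_iff_right (Nat.succ_ne_zero k)).1 key
  · ext i j
    exact (hD j i).trans ((congrFun (congrFun hTs i) j).trans (hD i j).symm)
  · ext i j
    simpa [mul_apply] using show b 0 i * b 0 j = ι (B i j) from (hB i j).symm
  · intro a i j
    exact congrArg Subtype.val (Subalgebra.mem_center_iff.1 a.2 ⟨b i j, hbA i j⟩).symm
  · intro i j
    rw [hJD, hJι', ← hY, hYtr, hYtr, smul_mul_smul_comm, mul_assoc θ, ← mul_assoc _ θ, hθX,
      neg_mul, mul_neg, ← mul_assoc, ← mul_assoc, hθθ]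
    simp
end Vanishing

section ColoredExterior
variable {N : ℕ}

/-- Left multiplication by the `i`-th generator of the algebra with generators `ξ i` and relations
`ξ i * ξ j = τ i j • ξ j * ξ i`, `ξ i ^ 2 = 0`, on functions on the basis of ordered monomials. -/
noncomputable def coloredMul (τ : Fin N → Fin N → ℂ) (i : Fin N) :
    Module.End ℂ (Finset (Fin N) → ℂ) where
  toFun f A := if i ∈ A then (∏ j ∈ A with j < i, τ i j) * f (A.erase i) else 0
  map_add' f g := by
    ext A
    simp only [Pi.add_apply]
    split_ifs <;> ring
  map_smul' c f := by
    ext A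
    simp only [Pi.smul_apply, smul_eq_mul, RingHom.id_apply]
    split_ifs <;> ring

theorem coloredMul_apply (τ : Fin N → Fin N → ℂ) (i : Fin N) (f : Finset (Fin N) → ℂ)
    (A : Finset (Fin N)) : coloredMul τ i f A =
      if i ∈ A then (∏ j ∈ A with j < i, τ i j) * f (A.erase i) else 0 := rfl

theorem coloredMul_mul_comm {τ : Fin N → Fin N → ℂ} (hτ : ∀ i j, τ i j * τ j i = 1) (i j : Fin N) :
    coloredMul τ i * coloredMul τ j = τ i j • (coloredMul τ j * coloredMul τ i) := by
  have key : ∀ i j, j < i → coloredMul τ i * coloredMul τ j =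
      τ i j • (coloredMul τ j * coloredMul τ i) := fun i j hij => by
    refine LinearMap.ext fun f => funext fun A => ?_
    simp only [Module.End.mul_apply, LinearMap.smul_apply, Pi.smul_apply, coloredMul_apply,
      smul_eq_mul, Finset.mem_erase]
    by_cases hi : i ∈ A <;> by_cases hj : j ∈ A <;> simp only [hi, hj, hij.ne, hij.ne', ne_eq,
      not_false_eq_true, and_false, if_true, if_false, mul_zero, and_self]
    have h1 : ((A.erase i).filter fun l => l < j) = A.filter fun l => l < j := by
      rw [Finset.filter_erase, Finset.erase_eq_of_notMem]
      simp [hij.le]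
    rw [Finset.erase_right_comm, ← Finset.mul_prod_erase _ _ (Finset.mem_filter.2 ⟨hj, hij⟩),
      ← Finset.filter_erase, h1]
    ring
  rcases lt_trichotomy i j with h | rfl | h
  · rw [key j i h, smul_smul, hτ, one_smul]
  · have : coloredMul τ i * coloredMul τ i = 0 := by
      refine LinearMap.ext fun f => funext fun A => ?_
      simp [Module.End.mul_apply, coloredMul_apply]
    rw [this, smul_zero]
  · exact key i j h

theorem coloredMul_prod_apply {τ : Fin N → Fin N → ℂ} {k : ℕ} {f : Fin k → Fin N}
    (hf : Function.Injective f) :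
    (List.ofFn fun p => coloredMul τ (f p)).prod (Pi.single ∅ 1) (Finset.univ.image f) =
      ∏ p, ∏ q, if p < q ∧ f q < f p then τ (f p) (f q) else 1 := by
  induction k with
  | zero => simp
  | succ k ih =>
    have h1 : (Finset.univ.image f).erase (f 0) =
        Finset.univ.image fun p : Fin k => f p.succ := by
      ext a
      simp only [Finset.mem_erase, Finset.mem_image, Finset.mem_univ, true_and, Fin.exists_fin_succ]
      constructor
      · rintro ⟨h1, h2 | h2⟩
        · exact absurd h2.symm h1
        · exact h2
      · rintro ⟨p, rfl⟩
        exact ⟨fun h => Fin.succ_ne_zero p (hf h), Or.inr ⟨p, rfl⟩⟩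
    rw [List.ofFn_succ, List.prod_cons, Module.End.mul_apply, coloredMul_apply,
      if_pos (Finset.mem_image_of_mem _ (Finset.mem_univ _)), h1,
      ih fun p q h => Fin.succ_injective _ (hf h), Finset.prod_filter,
      Finset.prod_image fun p _ q _ h => hf h, Fin.prod_univ_succ, Fin.prod_univ_succ]
    simp [Fin.prod_univ_succ]

theorem coloredMul_prod_apply_eq_zero {τ : Fin N → Fin N → ℂ} {k : ℕ} {f : Fin k → Fin N}
    {A : Finset (Fin N)} {a : Fin N} (ha : a ∈ A) (hf : ∀ p, f p ≠ a) :
    (List.ofFn fun p => coloredMul τ (f p)).prod (Pi.single ∅ 1) A = 0 := by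
  induction k generalizing A with
  | zero =>
    have : A ≠ ∅ := Finset.ne_empty_of_mem ha
    simp [this]
  | succ k ih =>
    rw [List.ofFn_succ, List.prod_cons, Module.End.mul_apply, coloredMul_apply,
      ih (Finset.mem_erase.2 ⟨(hf 0).symm, ha⟩) fun p => hf p.succ]
    simp
end ColoredExterior

section PowerExpansion

theorem Matrix.smul_list_prod_apply {ι m S : Type*} [Fintype m] [DecidableEq m] [Ring S]
    [Algebra ℂ S] (X : ι → Matrix m m ℂ) (ξ : ι → S) {k : ℕ} (r : Fin k → ι) (a b : m) :
    (List.ofFn fun p => (Matrix.of fun a b => X (r p) a b • ξ (r p) : Matrix m m S)).prod a b =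
      (List.ofFn fun p => X (r p)).prod a b • (List.ofFn fun p => ξ (r p)).prod := by
  induction k generalizing a with
  | zero =>
    rcases eq_or_ne a b with rfl | h
    · simp
    · simp [h]
  | succ k ih =>
    simp only [List.ofFn_succ, List.prod_cons, mul_apply, Finset.sum_smul, of_apply]
    exact Finset.sum_congr rfl fun c _ => by rw [ih (fun p => r p.succ), smul_mul_smul_comm]

theorem sum_pow_eq_sum_list_prod {ι R : Type*} [Fintype ι] [Ring R] [Algebra ℂ R] (E : ι → R)
    (k : ℕ) : (∑ i, E i) ^ k = ∑ r : Fin k → ι, (List.ofFn fun p => E (r p)).prod := by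
  classical
  have := (MultilinearMap.mkPiAlgebraFin ℂ k R).map_sum (fun (_ : Fin k) (i : ι) => E i)
  simpa using this

end PowerExpansion

section Osp

theorem prod_inversions_eq_sign_mul_superSign {k : ℕ} (σ : Equiv.Perm (Fin k))
    (px : Fin k → ZMod 2) :
    (∏ p, ∏ q, if p < q ∧ σ q < σ p then
      (if px (σ p) = 1 ∧ px (σ q) = 1 then (1 : ℂ) else -1) else 1) =
      ((Equiv.Perm.sign σ : ℤ) : ℂ) * superSign σ px := by
  have h1 : ((Equiv.Perm.sign σ : ℤ) : ℂ) =
      ∏ p, ∏ q, if p < q ∧ σ q < σ p then (-1 : ℂ) else 1 := by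
    rw [Equiv.Perm.sign_eq_prod_prod_Ioi]
    push_cast
    refine Finset.prod_congr rfl fun p _ => ?_
    rw [← Finset.prod_filter_mul_prod_filter_not Finset.univ (fun q => p < q)]
    rw [Finset.prod_eq_one (s := Finset.univ.filter fun q => ¬ p < q), mul_one]
    · refine Finset.prod_congr (by ext; simp) fun q hq => ?_
      have hpq : p < q := (Finset.mem_filter.1 hq).2
      rcases lt_or_gt_of_ne (σ.injective.ne hpq.ne) with h | h
      · simp [h, h.le, hpq]
      · simp [h, h.not_gt, hpq]
    · intro q hq
      have hpq := (Finset.mem_filter.1 hq).2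
      simp [hpq]
  have h2 : superSign σ px = ∏ p, ∏ q,
      if p < q ∧ σ q < σ p ∧ px (σ p) = 1 ∧ px (σ q) = 1 then (-1 : ℂ) else 1 := by
    rw [superSign, ← Finset.prod_const, Finset.prod_filter, Fintype.prod_prod_type]
  rw [h1, h2, ← Finset.prod_mul_distrib]
  refine Finset.prod_congr rfl fun p _ => ?_
  rw [← Finset.prod_mul_distrib]
  refine Finset.prod_congr rfl fun q _ => ?_
  by_cases h3 : p < q <;> by_cases h4 : σ q < σ p <;>
    by_cases h5 : px (σ p) = 1 <;> by_cases h6 : px (σ q) = 1 <;> simp [h3, h4, h5, h6]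

variable {n : ℕ}

theorem transpose_toBlocks₂₂_Bmat : (Bmat n).toBlocks₂₂ᵀ = -(Bmat n).toBlocks₂₂ := by
  ext a b
  simp only [transpose_apply, Matrix.neg_apply, toBlocks₂₂, of_apply, Bmat]
  split_ifs <;> first | omega | simp

theorem toBlocks₂₂_Bmat_mul_self : (Bmat n).toBlocks₂₂ * (Bmat n).toBlocks₂₂ = -1 := by
  have hB : ∀ a c : Fin (2 * n), (Bmat n).toBlocks₂₂ a c =
    if a.val + n = c.val then 1 else if c.val + n = a.val then -1 else 0 := fun _ _ => rfl
  ext a b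
  rw [mul_apply, Matrix.neg_apply, one_apply]
  simp only [hB, Fin.ext_iff]
  by_cases ha : a.val < n
  · rw [Finset.sum_eq_single (⟨a.val + n, by omega⟩ : Fin (2 * n))]
    · simp only [if_true, one_mul]
      split_ifs <;> first | omega | simp
    · intro c _ hc
      rw [if_neg fun h => hc (Fin.ext h.symm), if_neg (by omega), zero_mul]
    · simp
  · rw [Finset.sum_eq_single (⟨a.val - n, by omega⟩ : Fin (2 * n))]
    · rw [if_neg (by simp; omega), if_pos (by simp; omega)]
      simp only
      split_ifs <;> first | omega | simp
    · intro c _ hc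
      rw [if_neg (by omega), if_neg fun h => hc (Fin.ext (by simp; omega)), zero_mul]
    · simp

theorem ospMem.transpose_mul_add {X : Matrix (Idx 1 (2 * n)) (Idx 1 (2 * n)) ℂ} {ε : ZMod 2}
    (h : ospMem X ε) (a b : Idx 1 (2 * n)) :
    (Xᵀ * Bmat n) a b + sgn (ε * ipar a) * (Bmat n * X) a b = 0 := by
  have hp : ∀ c : Idx 1 (2 * n), VHasParity (Pi.single c 1) (ipar c) := fun c i hi =>
    Pi.single_eq_of_ne (fun h => hi (by rw [h])) 1
  have := h.2 (Pi.single a 1) (Pi.single b 1) _ _ (hp a) (hp b)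
  simpa [Bform, Matrix.mul_apply, Pi.single_apply] using this

theorem ospMem.exists_eq_fromBlocks {X : Matrix (Idx 1 (2 * n)) (Idx 1 (2 * n)) ℂ} {ε : ZMod 2}
    (h : ospMem X ε) :
    ∃ (y : Matrix (Fin 1) (Fin (2 * n)) ℂ) (W : Matrix (Fin (2 * n)) (Fin (2 * n)) ℂ),
      Wᵀ = W ∧ X = fromBlocks 0 y (-(Bmat n).toBlocks₂₂ * yᵀ) (-(Bmat n).toBlocks₂₂ * W) ∧
      (ε = 1 → W = 0) ∧ (ε ≠ 1 → y = 0) := by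
  set K := (Bmat n).toBlocks₂₂ with hK
  have hB : Bmat n = fromBlocks 1 0 0 K := by
    ext (a | a) (b | b)
    · rw [Subsingleton.elim a b]; simp [Bmat]
    · rfl
    · rfl
    · rfl
  have hXe := X.fromBlocks_toBlocks.symm
  generalize X.toBlocks₁₁ = P at hXe
  generalize X.toBlocks₁₂ = y at hXe
  generalize X.toBlocks₂₁ = z at hXe
  generalize X.toBlocks₂₂ = D at hXe
  have hKt : Kᵀ = -K := transpose_toBlocks₂₂_Bmat
  have hKK : K * K = -1 := toBlocks₂₂_Bmat_mul_self
  have h1 := h.transpose_mul_add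
  have h2 := h.1
  rw [hXe, hB, fromBlocks_transpose, fromBlocks_multiply, fromBlocks_multiply] at h1
  rw [hXe] at h2
  have hP : P = 0 := by
    ext a b
    have := h1 (Sum.inl a) (Sum.inl b)
    rw [Subsingleton.elim a b] at this ⊢
    simp [ipar, sgn] at this
    simpa using this
  have hy : zᵀ * K + y = 0 := by
    ext a b
    simpa [ipar, sgn] using h1 (Sum.inl a) (Sum.inr b)
  have hz : z = -K * yᵀ := by
    have h3 : yᵀ = K * z := by
      rw [eq_neg_of_add_eq_zero_right hy, transpose_neg, transpose_mul, transpose_transpose, hKt,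
        Matrix.neg_mul, neg_neg]
    rw [h3, ← Matrix.mul_assoc, Matrix.neg_mul, hKK, neg_neg, Matrix.one_mul]
  have hD : D = -K * (K * D) := by
    rw [← Matrix.mul_assoc, Matrix.neg_mul, hKK, neg_neg, Matrix.one_mul]
  refine ⟨y, K * D, ?_, ?_, ?_, ?_⟩
  · rw [transpose_mul, hKt, Matrix.mul_neg]
    rcases eq_or_ne ε 1 with rfl | hε
    · have : D = 0 := by
        ext a b
        exact h2 (Sum.inr a) (Sum.inr b) (by simp [ipar])
      simp [this]
    · have hε0 : ε = 0 := (by decide : ∀ e : ZMod 2, e ≠ 1 → e = 0) ε hε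
      ext a b
      have := h1 (Sum.inr a) (Sum.inr b)
      rw [hε0] at this
      rw [Matrix.neg_apply]
      simp [sgn] at this
      linear_combination -this
  · rw [← hz, ← hD, ← hP, hXe]
  · rintro rfl
    have : D = 0 := by
      ext a b
      exact h2 (Sum.inr a) (Sum.inr b) (by simp [ipar])
    rw [this, Matrix.mul_zero]
  · intro hε
    ext a b
    simpa using h2 (Sum.inl a) (Sum.inr b) fun h3 =>
      hε ((by decide : ∀ e : ZMod 2, (0 : ZMod 2) = 1 + e → e = 1) ε h3)

end Osp

section SuperColor

/-- The commutation factor `1` between two odd generators and `-1` otherwise. -/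
noncomputable def superColor {N : ℕ} (P : Fin N → ZMod 2) (i j : Fin N) : ℂ :=
  if P i = 1 ∧ P j = 1 then 1 else -1

theorem superColor_mul_comm {N : ℕ} (P : Fin N → ZMod 2) (i j : Fin N) :
    superColor P i j * superColor P j i = 1 := by
  by_cases hi : P i = 1 <;> by_cases hj : P j = 1 <;> simp [superColor, hi, hj]

theorem isTwistedSupercommuting_coloredMul {N : ℕ} (P : Fin N → ZMod 2) :
    IsTwistedSupercommuting (coloredMul (superColor P) '' {i | P i = 1})
      (coloredMul (superColor P) '' {i | P i ≠ 1}) where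
  oo := by
    rintro _ ⟨i, hi, rfl⟩ _ ⟨j, hj, rfl⟩
    rw [coloredMul_mul_comm (superColor_mul_comm P), superColor, if_pos ⟨hi, hj⟩, one_smul]
  oe := by
    rintro _ ⟨i, _, rfl⟩ _ ⟨j, hj, rfl⟩
    rw [coloredMul_mul_comm (superColor_mul_comm P), superColor, if_neg fun h => hj h.2]
    exact LinearMap.ext fun f => by simp
  ee := by
    rintro _ ⟨i, _, rfl⟩ _ ⟨j, hj, rfl⟩
    rw [coloredMul_mul_comm (superColor_mul_comm P), superColor, if_neg fun h => hj h.2]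
    exact LinearMap.ext fun f => by simp

theorem superTrace_sum_pow_apply {k p q : ℕ} (X : Fin k → Matrix (Idx p q) (Idx p q) ℂ)
    (px : Fin k → ZMod 2) {P : Fin (k + 1) → ZMod 2} (hP : ∀ i, P i.succ = px i) :
    ((∑ i, (Matrix.of fun a b => X i a b • coloredMul (superColor P) i.succ :
      Matrix (Idx p q) (Idx p q) (Module.End ℂ (Finset (Fin (k + 1)) → ℂ)))) ^ k).superTrace
      (Pi.single ∅ 1) (Finset.univ.erase 0) = strace (skewPoly X px) := by
  have hsum : ∀ a b, ((∑ i, (Matrix.of fun a b => X i a b • coloredMul (superColor P) i.succ :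
      Matrix (Idx p q) (Idx p q) (Module.End ℂ (Finset (Fin (k + 1)) → ℂ)))) ^ k) a b
      (Pi.single ∅ 1) (Finset.univ.erase 0) = skewPoly X px a b := fun a b => by
    rw [sum_pow_eq_sum_list_prod, Matrix.sum_apply, LinearMap.sum_apply, Finset.sum_apply]
    simp only [Matrix.smul_list_prod_apply X (fun i : Fin k => coloredMul (superColor P) i.succ),
      LinearMap.smul_apply, Pi.smul_apply, smul_eq_mul]
    rw [skewPoly, Matrix.sum_apply]
    symm
    refine Fintype.sum_of_injective (fun σ : Equiv.Perm (Fin k) => (σ : Fin k → Fin k))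
      DFunLike.coe_injective _ _ (fun r hr => ?_) fun σ => ?_
    · have : ¬ Function.Surjective r := fun h => hr
        ⟨Equiv.ofBijective r (Finite.surjective_iff_bijective.1 h), rfl⟩
      obtain ⟨c, hc⟩ := not_forall.1 this
      rw [coloredMul_prod_apply_eq_zero (f := fun i => (r i).succ) (a := c.succ)
        (by simp) fun i h => hc ⟨i, Fin.succ_injective _ h⟩, mul_zero]
    · have hA : (Finset.univ.erase 0 : Finset (Fin (k + 1))) =
          Finset.univ.image fun i => (σ i).succ := by
        ext i
        cases i using Fin.cases with
        | zero => simp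
        | succ i => simpa using ⟨σ.symm i, by simp⟩
      rw [hA, coloredMul_prod_apply (f := fun i => (σ i).succ)
        ((Fin.succ_injective _).comp σ.injective), Matrix.smul_apply, smul_eq_mul, permProd,
        mul_comm, ← prod_inversions_eq_sign_mul_superSign]
      simp only [Fin.succ_lt_succ_iff, superColor, hP]
  simp [Matrix.superTrace_eq_sum, strace, hsum, gradeSign, sub_eq_add_neg]

theorem mul_superTrace_sum_pow_eq_zero {S : Type*} [Ring S] [Algebra ℂ S] {gO gE : Set S}
    (h : IsTwistedSupercommuting gO gE) {θ : S} (hθ : θ ∈ gE) {ι : Type*} [Fintype ι] {n : ℕ}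
    {X : ι → Matrix (Idx 1 (2 * n)) (Idx 1 (2 * n)) ℂ} {px : ι → ZMod 2}
    (hX : ∀ i, ospMem (X i) (px i)) {ξ : ι → S} (hO : ∀ i, px i = 1 → ξ i ∈ gO)
    (hE : ∀ i, px i ≠ 1 → ξ i ∈ gE) {k : ℕ} (hk : 2 * n ≤ k) :
    θ * ((∑ i, (Matrix.of fun a b => X i a b • ξ i : Matrix (Idx 1 (2 * n)) (Idx 1 (2 * n)) S)) ^
      (2 * k + 1)).superTrace = 0 := by
  choose y W hW hXW hW0 hy0 using fun i => (hX i).exists_eq_fromBlocks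
  set J := -(Bmat n).toBlocks₂₂
  have hJ : Jᵀ = -J := by rw [transpose_neg, transpose_toBlocks₂₂_Bmat]
  set x : Matrix (Fin 1) (Fin (2 * n)) S := of fun a b => ∑ i, y i a b • ξ i
  set Ω : Matrix (Fin (2 * n)) (Fin (2 * n)) S := of fun a b => ∑ i, W i a b • ξ i
  have hx : ∀ a b, x a b ∈ Submodule.span ℂ gO := fun a b => by
    refine Submodule.sum_mem _ fun i _ => ?_
    by_cases hi : px i = 1
    · exact Submodule.smul_mem _ _ (Submodule.subset_span (hO i hi))
    · simp [hy0 i hi]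
  have hΩ : ∀ a b, Ω a b ∈ Submodule.span ℂ gE := fun a b => by
    refine Submodule.sum_mem _ fun i _ => ?_
    by_cases hi : px i = 1
    · simp [hW0 i hi]
    · exact Submodule.smul_mem _ _ (Submodule.subset_span (hE i hi))
  have hΩs : Ωᵀ = Ω := by
    ext1 a b
    refine Finset.sum_congr rfl fun i _ => ?_
    rw [← Matrix.transpose_apply (W i), hW]
  have hJsum : ∀ {c : Type} (a : Fin (2 * n)) (b : c) (Z : ι → Matrix (Fin (2 * n)) c ℂ),
      ∑ i, (J * Z i) a b • ξ i =
        (J.map (algebraMap ℂ S) * of fun a b => ∑ i, Z i a b • ξ i) a b := fun a b Z => by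
    simp only [mul_apply, Finset.sum_smul, Finset.mul_sum, map_apply, of_apply, mul_smul,
      ← Algebra.smul_def]
    exact Finset.sum_comm
  have hsum : (∑ i, (of fun a b => X i a b • ξ i : Matrix (Idx 1 (2 * n)) (Idx 1 (2 * n)) S)) =
      fromBlocks 0 x (J.map (algebraMap ℂ S) * xᵀ) (J.map (algebraMap ℂ S) * Ω) := by
    ext1 a b
    rw [Matrix.sum_apply]
    simp only [of_apply]
    rw [Finset.sum_congr rfl fun i _ => by rw [hXW i]]
    rcases a with a | a <;> rcases b with b | b
    · simp
    · rfl
    · exact hJsum a b fun i => (y i)ᵀ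
    · exact hJsum a b W
  rw [hsum]
  exact mul_superTrace_pow_eq_zero h hθ hJ hx hΩ hΩs (by simpa using hk)

end SuperColor

/-- The invariant `Λ_{4n+3} = str ∘ 𝒜_{4n+3}` vanishes identically on `osp(1,2n)`. -/
theorem strace_skewPoly_vanish_osp (n : ℕ) (hn : 1 ≤ n)
    (X : Fin (4*n+3) → Matrix (Idx 1 (2*n)) (Idx 1 (2*n)) ℂ)
    (px : Fin (4*n+3) → ZMod 2) (hX : ∀ i, ospMem (X i) (px i)) :
    strace (skewPoly X px) = 0 := by
  set P : Fin (4 * n + 3 + 1) → ZMod 2 := Fin.cons 0 px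
  have hP : ∀ i, P i.succ = px i := fun _ => rfl
  have key := mul_superTrace_sum_pow_eq_zero (isTwistedSupercommuting_coloredMul P)
    (θ := coloredMul (superColor P) 0) ⟨0, zero_ne_one, rfl⟩ hX
    (ξ := fun i => coloredMul (superColor P) i.succ) (fun i hi => ⟨_, hi, rfl⟩)
    (fun i hi => ⟨_, hi, rfl⟩) (Nat.le_succ _)
  rw [show 2 * (2 * n).succ + 1 = 4 * n + 3 by omega] at key
  have h0 := congrFun (LinearMap.congr_fun key (Pi.single ∅ 1)) Finset.univ
  rw [Module.End.mul_apply, coloredMul_apply, if_pos (Finset.mem_univ _)] at h0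
  rw [← superTrace_sum_pow_apply X px hP]
  simpa using h0
end
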